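/- Fix a mean m on C_b(X). Let f₁, f₂, f₃, f₄ ∈ C_b(X) with 0 ≤ f_i ≤ 1 pointwise for each i, and suppose that each of the four sums f₁+f₃, f₁+f₄, f₂+f₃, f₂+f₄ is small. Then f₁·f₂ + f₃·f₄ is small. -/

import Mathlib

open BoundedContinuousFunction

/-- A mean on `C_b(X)`: a linear functional that is positive on nonnegative functions
and sends the constant function `1` to `1`. -/
def IsMean {X : Type*} [TopologicalSpace X] (m : (X →ᵇ ℝ) →ₗ[ℝ] ℝ) : Prop :=
  (∀ f : X →ᵇ ℝ, (∀ x, 0 ≤ f x) → 0 ≤ m f) ∧ m 1 = 1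

/-- `m∞(f) = sup_{λ ≥ 0} m(min(λ·f, 1))`, where `min` is the pointwise minimum. -/
noncomputable def mInfty {X : Type*} [TopologicalSpace X]
    (m : (X →ᵇ ℝ) →ₗ[ℝ] ℝ) (f : X →ᵇ ℝ) : ℝ :=
  ⨆ l : {l : ℝ // 0 ≤ l}, m ((l.1 • f) ⊓ 1)

/-- `f` is small (with respect to the mean `m`) if `f ≥ 0` pointwise and `m∞(f) = 1`. -/
def IsSmall {X : Type*} [TopologicalSpace X] (m : (X →ᵇ ℝ) →ₗ[ℝ] ℝ) (f : X →ᵇ ℝ) : Prop :=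
  (∀ x, 0 ≤ f x) ∧ mInfty m f = 1

section Mean

variable {X : Type*} [TopologicalSpace X] {m : (X →ᵇ ℝ) →ₗ[ℝ] ℝ}

theorem IsMean.mono (hm : IsMean m) {f g : X →ᵇ ℝ} (h : ∀ x, f x ≤ g x) : m f ≤ m g := by
  have := hm.1 (g - f) fun x => by simpa using h x
  rwa [map_sub, sub_nonneg] at this

theorem IsMean.apply_smul_inf_one_le (hm : IsMean m) (f : X →ᵇ ℝ) (l : ℝ) :
    m ((l • f) ⊓ 1) ≤ 1 :=
  (hm.mono fun x => by simp).trans_eq hm.2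

/-- Smallness of `f` says that `m (min (l • f) 1)` gets arbitrarily close to `1`. -/
theorem isSmall_iff (hm : IsMean m) {f : X →ᵇ ℝ} :
    IsSmall m f ↔
      (∀ x, 0 ≤ f x) ∧ ∀ ε > 0, ∃ l : ℝ, 0 ≤ l ∧ 1 - ε < m ((l • f) ⊓ 1) := by
  have : Nonempty {l : ℝ // 0 ≤ l} := ⟨⟨0, le_rfl⟩⟩
  refine and_congr_right fun _ => ⟨fun h ε hε => ?_, fun h => ?_⟩
  · obtain ⟨l, hl⟩ := exists_lt_of_lt_ciSup (show 1 - ε < mInfty m f by rw [h]; linarith)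
    exact ⟨l, l.2, hl⟩
  · refine ciSup_eq_of_forall_le_of_forall_lt_exists_gt
      (fun l => hm.apply_smul_inf_one_le f l) fun w hw => ?_
    obtain ⟨l, hl, hlt⟩ := h (1 - w) (by linarith)
    exact ⟨⟨l, hl⟩, by simpa using hlt⟩

/-- A nonnegative function, a multiple of which dominates a small function, is small. -/
theorem IsSmall.of_le_smul (hm : IsMean m) {f g : X →ᵇ ℝ} (hf : IsSmall m f)
    (hg : ∀ x, 0 ≤ g x) {c : ℝ} (hc : 0 ≤ c) (h : ∀ x, f x ≤ c * g x) : IsSmall m g := by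
  refine (isSmall_iff hm).2 ⟨hg, fun ε hε => ?_⟩
  obtain ⟨l, hl, hlt⟩ := ((isSmall_iff hm).1 hf).2 ε hε
  refine ⟨l * c, mul_nonneg hl hc, hlt.trans_le (hm.mono fun x => ?_)⟩
  have : l * f x ≤ l * c * g x := by
    rw [mul_assoc]
    exact mul_le_mul_of_nonneg_left (h x) hl
  exact min_le_min_right 1 this

theorem min_add_min_sub_one_le_min_mul {a b : ℝ} (ha : 0 ≤ a) (hb : 0 ≤ b) :
    min a 1 + min b 1 - 1 ≤ min (a * b) 1 := by
  have ha' : 0 ≤ min a 1 := le_min ha zero_le_one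
  have hb' : 0 ≤ min b 1 := le_min hb zero_le_one
  have h : min a 1 * min b 1 ≤ a * b :=
    mul_le_mul (min_le_left _ _) (min_le_left _ _) hb' ha
  have ha₁ := min_le_right a 1
  have hb₁ := min_le_right b 1
  exact le_min (by nlinarith) (by linarith)

theorem IsSmall.mul (hm : IsMean m) {f g : X →ᵇ ℝ} (hf : IsSmall m f) (hg : IsSmall m g) :
    IsSmall m (f * g) := by
  refine (isSmall_iff hm).2 ⟨fun x => mul_nonneg (hf.1 x) (hg.1 x), fun ε hε => ?_⟩
  obtain ⟨k, hk, hfk⟩ := ((isSmall_iff hm).1 hf).2 (ε / 2) (half_pos hε)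
  obtain ⟨l, hl, hgl⟩ := ((isSmall_iff hm).1 hg).2 (ε / 2) (half_pos hε)
  refine ⟨k * l, mul_nonneg hk hl, ?_⟩
  have key : m ((k • f) ⊓ 1 + (l • g) ⊓ 1 - 1) ≤ m (((k * l) • (f * g)) ⊓ 1) :=
    hm.mono fun x => by
      have := min_add_min_sub_one_le_min_mul (mul_nonneg hk (hf.1 x)) (mul_nonneg hl (hg.1 x))
      rwa [mul_mul_mul_comm] at this
  rw [map_sub, map_add, hm.2] at key
  linarith

end Mean

theorem add_mul_add_mul_add_mul_add_le {a b c d : ℝ} (ha : 0 ≤ a ∧ a ≤ 1) (hb : 0 ≤ b ∧ b ≤ 1)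
    (hc : 0 ≤ c ∧ c ≤ 1) (hd : 0 ≤ d ∧ d ≤ 1) :
    (a + c) * (a + d) * ((b + c) * (b + d)) ≤ 8 * (a * b + c * d) := by
  obtain ⟨ha, ha₁⟩ := ha
  obtain ⟨hb, hb₁⟩ := hb
  obtain ⟨hc, hc₁⟩ := hc
  obtain ⟨hd, hd₁⟩ := hd
  have hab := mul_nonneg ha hb
  have hcd := mul_nonneg hc hd
  have h₁ : a * b + c * d + (a * d + b * c) + (a * c + b * d) ≤ 6 := by
    linarith [mul_le_one₀ ha₁ hb hb₁, mul_le_one₀ hc₁ hd hd₁, mul_le_one₀ ha₁ hd hd₁,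
      mul_le_one₀ hb₁ hc hc₁, mul_le_one₀ ha₁ hc hc₁, mul_le_one₀ hb₁ hd hd₁]
  have h₂ : c * d * (a ^ 2 + b ^ 2) ≤ c * d * 2 :=
    mul_le_mul_of_nonneg_left (by nlinarith) hcd
  have h₃ : a * b * (c ^ 2 + d ^ 2) ≤ a * b * 2 :=
    mul_le_mul_of_nonneg_left (by nlinarith) hab
  have h₄ := mul_le_mul_of_nonneg_left h₁ (add_nonneg hab hcd)
  linarith

/-- If `0 ≤ fᵢ ≤ 1` pointwise for `i = 1,2,3,4` and each of the sums
`f₁+f₃, f₁+f₄, f₂+f₃, f₂+f₄` is small, then `f₁·f₂ + f₃·f₄` is small. -/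
theorem isSmall_mul_add_mul {X : Type*} [TopologicalSpace X] [Nonempty X]
    (m : (X →ᵇ ℝ) →ₗ[ℝ] ℝ) (hm : IsMean m) (f₁ f₂ f₃ f₄ : X →ᵇ ℝ)
    (h₁ : ∀ x, 0 ≤ f₁ x ∧ f₁ x ≤ 1) (h₂ : ∀ x, 0 ≤ f₂ x ∧ f₂ x ≤ 1)
    (h₃ : ∀ x, 0 ≤ f₃ x ∧ f₃ x ≤ 1) (h₄ : ∀ x, 0 ≤ f₄ x ∧ f₄ x ≤ 1)
    (h₁₃ : IsSmall m (f₁ + f₃)) (h₁₄ : IsSmall m (f₁ + f₄))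
    (h₂₃ : IsSmall m (f₂ + f₃)) (h₂₄ : IsSmall m (f₂ + f₄)) :
    IsSmall m (f₁ * f₂ + f₃ * f₄) := by
  refine ((h₁₃.mul hm h₁₄).mul hm (h₂₃.mul hm h₂₄)).of_le_smul hm (c := 8) (fun x => ?_)
    (by norm_num) fun x => add_mul_add_mul_add_mul_add_le (h₁ x) (h₂ x) (h₃ x) (h₄ x)
  exact add_nonneg (mul_nonneg (h₁ x).1 (h₂ x).1) (mul_nonneg (h₃ x).1 (h₄ x).1)
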